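/- arXiv:2010.14349 — 7 statements merged into one kernel-verified Lean document; each statement's English description precedes it below -/
import Mathlib

section
/- The star chromatic index of the complete graph K_4 equals 5; that is, K_4 admits a star 5-edge-coloring but no star 4-edge-coloring. -/
/-- A star `k`-edge-coloring of `G`: a proper edge-coloring (adjacent edges get
distinct colors) such that no path and no cycle with exactly four edges is
bicolored.  The walks `v₀v₁v₂v₃v₄` with consecutive vertices adjacent and with
`v₀,v₁,v₂,v₃` pairwise distinct and `v₁,v₂,v₃,v₄` pairwise distinct are exactly
the paths (when `v₀ ≠ v₄`) and cycles (when `v₀ = v₄`) with four edges; being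
bicolored under a proper coloring means the colors alternate. -/
def IsStarEdgeColoring {V : Type*} (G : SimpleGraph V) {k : ℕ} (c : Sym2 V → Fin k) : Prop :=
  (∀ ⦃u v w : V⦄, G.Adj u v → G.Adj u w → v ≠ w → c s(u, v) ≠ c s(u, w)) ∧
  (∀ v₀ v₁ v₂ v₃ v₄ : V, G.Adj v₀ v₁ → G.Adj v₁ v₂ → G.Adj v₂ v₃ → G.Adj v₃ v₄ →
    v₀ ≠ v₂ → v₀ ≠ v₃ → v₁ ≠ v₃ → v₁ ≠ v₄ → v₂ ≠ v₄ →
    ¬(c s(v₀, v₁) = c s(v₂, v₃) ∧ c s(v₁, v₂) = c s(v₃, v₄)))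

/-- The star chromatic index of `G`: the least `k` such that `G` admits a
star `k`-edge-coloring. -/
noncomputable def starChromaticIndex {V : Type*} (G : SimpleGraph V) : ℕ :=
  sInf {k : ℕ | ∃ c : Sym2 V → Fin k, IsStarEdgeColoring G c}

/-- The edge-coloring of `K₄` in which exactly one perfect matching is monochromatic and the
remaining four edges receive four further colors. -/
def fiveColoringK4 (e : Sym2 (Fin 4)) : Fin 5 :=
  if e = s(0, 2) then 1 else if e = s(1, 3) then 2 else
  if e = s(0, 3) then 3 else if e = s(1, 2) then 4 else 0

theorem isStarEdgeColoring_fiveColoringK4 :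
    IsStarEdgeColoring (⊤ : SimpleGraph (Fin 4)) fiveColoringK4 := by
  constructor
  · intro u v w
    simp only [SimpleGraph.top_adj]
    revert u v w
    decide
  · have alternate : ∀ v₀ v₁ v₂ v₃ v₄ : Fin 4, [v₀, v₁, v₂, v₃].Nodup → [v₁, v₂, v₃, v₄].Nodup →
        ¬(fiveColoringK4 s(v₀, v₁) = fiveColoringK4 s(v₂, v₃) ∧
          fiveColoringK4 s(v₁, v₂) = fiveColoringK4 s(v₃, v₄)) := by decide
    intro v₀ v₁ v₂ v₃ v₄ h₀₁ h₁₂ h₂₃ h₃₄ h₀₂ h₀₃ h₁₃ h₁₄ h₂₄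
    rw [SimpleGraph.top_adj] at h₀₁ h₁₂ h₂₃ h₃₄
    exact alternate v₀ v₁ v₂ v₃ v₄ (by simp [*]) (by simp [*])

theorem IsStarEdgeColoring.five_le {k : ℕ} {c : Sym2 (Fin 4) → Fin k}
    (hc : IsStarEdgeColoring (⊤ : SimpleGraph (Fin 4)) c) : 5 ≤ k := by
  obtain ⟨proper, star⟩ := hc
  simp only [SimpleGraph.top_adj] at proper star
  have adjacent (u v w : Fin 4) (huv : u ≠ v := by decide) (huw : u ≠ w := by decide)
      (hvw : v ≠ w := by decide) : c s(u, v) ≠ c s(u, w) := proper huv huw hvw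
  have cycle (u v w x : Fin 4) (huv : u ≠ v := by decide) (huw : u ≠ w := by decide)
      (hux : u ≠ x := by decide) (hvw : v ≠ w := by decide) (hvx : v ≠ x := by decide)
      (hwx : w ≠ x := by decide) : ¬(c s(u, v) = c s(w, x) ∧ c s(v, w) = c s(x, u)) :=
    star u v w x u huv hvw hwx hux.symm huw hux hvx huv.symm huw.symm
  have five_distinct (l : List (Fin k)) (hl : l.Nodup) (h : l.length = 5) : 5 ≤ k := by
    simpa [h] using hl.length_le_card
  have h₀₁ := adjacent 0 1 2
  have h₀₂ := adjacent 0 1 3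
  have h₀₃ := adjacent 0 2 3
  have h₁₁ := adjacent 1 0 2
  have h₁₂ := adjacent 1 0 3
  have h₁₃ := adjacent 1 2 3
  have h₂₁ := adjacent 2 0 1
  have h₂₂ := adjacent 2 0 3
  have h₂₃ := adjacent 2 1 3
  have h₃₁ := adjacent 3 0 1
  have h₃₂ := adjacent 3 0 2
  have h₃₃ := adjacent 3 1 2
  have c₁ := cycle 0 1 2 3
  have c₂ := cycle 0 1 3 2
  have c₃ := cycle 0 2 1 3
  simp only [Sym2.eq_swap (a := (1 : Fin 4)) (b := 0), Sym2.eq_swap (a := (2 : Fin 4)) (b := 0),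
    Sym2.eq_swap (a := (3 : Fin 4)) (b := 0), Sym2.eq_swap (a := (2 : Fin 4)) (b := 1),
    Sym2.eq_swap (a := (3 : Fin 4)) (b := 1), Sym2.eq_swap (a := (3 : Fin 4)) (b := 2)] at *
  clear proper star adjacent cycle
  generalize c s(0, 1) = a, c s(2, 3) = a', c s(0, 2) = b, c s(1, 3) = b', c s(0, 3) = d,
    c s(1, 2) = d' at *
  by_cases ha : a = a'
  · refine five_distinct [a, b, b', d, d'] ?_ rfl
    simp only [List.nodup_cons, List.mem_cons, List.not_mem_nil, List.nodup_nil]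
    grind
  · by_cases hb : b = b'
    · refine five_distinct [a, a', b, d, d'] ?_ rfl
      simp only [List.nodup_cons, List.mem_cons, List.not_mem_nil, List.nodup_nil]
      grind
    · refine five_distinct [a, a', b, b', d] ?_ rfl
      simp only [List.nodup_cons, List.mem_cons, List.not_mem_nil, List.nodup_nil]
      grind

/-- The star chromatic index of the complete graph `K₄` equals 5: `K₄` admits a
star 5-edge-coloring but no star 4-edge-coloring. -/
theorem starChromaticIndex_K4 :
    starChromaticIndex (⊤ : SimpleGraph (Fin 4)) = 5 := by
  have mem : 5 ∈ {k : ℕ | ∃ c : Sym2 (Fin 4) → Fin k, IsStarEdgeColoring ⊤ c} :=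
    ⟨fiveColoringK4, isStarEdgeColoring_fiveColoringK4⟩
  refine le_antisymm (Nat.sInf_le mem) (le_csInf ⟨5, mem⟩ ?_)
  rintro k ⟨c, hc⟩
  exact hc.five_le
end

section
/- The star chromatic index of the net graph equals 4. -/
/-- The net graph: a triangle on vertices `0, 1, 2` together with a pendant
vertex attached to each triangle vertex (`3` to `0`, `4` to `1`, `5` to `2`). -/
def netGraph : SimpleGraph (Fin 6) :=
  SimpleGraph.fromRel (fun a b =>
    (a = 0 ∧ b = 1) ∨ (a = 1 ∧ b = 2) ∨ (a = 0 ∧ b = 2) ∨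
    (a = 0 ∧ b = 3) ∨ (a = 1 ∧ b = 4) ∨ (a = 2 ∧ b = 5))

instance : DecidableRel netGraph.Adj := fun a b => by
  unfold netGraph
  rw [SimpleGraph.fromRel_adj]
  infer_instance

/-- The edge-coloring of the net graph whose triangle edges get the colors `0`, `1`, `2` and
whose pendant edges all get the color `3`. -/
def netColoring (e : Sym2 (Fin 6)) : Fin 4 :=
  if e = s(0, 1) then 0 else if e = s(1, 2) then 1 else if e = s(0, 2) then 2 else 3

lemma isStarEdgeColoring_netColoring : IsStarEdgeColoring netGraph netColoring := by
  constructor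
  · decide
  · have h : ∀ v₀ v₁, netGraph.Adj v₀ v₁ → ∀ v₂, netGraph.Adj v₁ v₂ → v₀ ≠ v₂ →
        ∀ v₃, netGraph.Adj v₂ v₃ → v₀ ≠ v₃ → v₁ ≠ v₃ →
        netColoring s(v₀, v₁) = netColoring s(v₂, v₃) →
        ∀ v₄, netGraph.Adj v₃ v₄ → v₁ ≠ v₄ → v₂ ≠ v₄ →
        netColoring s(v₁, v₂) ≠ netColoring s(v₃, v₄) := by
      decide
    rintro v₀ v₁ v₂ v₃ v₄ h₀₁ h₁₂ h₂₃ h₃₄ n₀₂ n₀₃ n₁₃ n₁₄ n₂₄ ⟨e, e'⟩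
    exact h v₀ v₁ h₀₁ v₂ h₁₂ n₀₂ v₃ h₂₃ n₀₃ n₁₃ e v₄ h₃₄ n₁₄ n₂₄ e'

/-- With at most three colors, properness forces each pendant edge to repeat the color of the
opposite triangle edge, so the path `3, 0, 1, 2, 5` is bicolored. -/
lemma four_le_of_isStarEdgeColoring_netGraph {k : ℕ} {c : Sym2 (Fin 6) → Fin k}
    (hc : IsStarEdgeColoring netGraph c) : 4 ≤ k := by
  obtain ⟨proper, star⟩ := hc
  have h₀ := @proper 0 1 2 (by decide) (by decide) (by decide)
  have h₁ := @proper 0 1 3 (by decide) (by decide) (by decide)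
  have h₂ := @proper 0 2 3 (by decide) (by decide) (by decide)
  have h₃ := @proper 1 0 2 (by decide) (by decide) (by decide)
  have h₄ := @proper 2 0 1 (by decide) (by decide) (by decide)
  have h₅ := @proper 2 0 5 (by decide) (by decide) (by decide)
  have h₆ := @proper 2 1 5 (by decide) (by decide) (by decide)
  have h := star 3 0 1 2 5 (by decide) (by decide) (by decide) (by decide) (by decide)
    (by decide) (by decide) (by decide) (by decide)
  rw [Sym2.eq_swap (a := 1) (b := 0)] at h₃
  rw [Sym2.eq_swap (a := 2) (b := 0)] at h₄ h₅
  rw [Sym2.eq_swap (a := 2) (b := 1)] at h₄ h₆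
  rw [Sym2.eq_swap (a := 3) (b := 0)] at h
  simp only [ne_eq, Fin.ext_iff] at *
  omega

/-- The star chromatic index of the net graph equals 4. -/
theorem starChromaticIndex_net : starChromaticIndex netGraph = 4 := by
  have hmem : 4 ∈ {k : ℕ | ∃ c : Sym2 (Fin 6) → Fin k, IsStarEdgeColoring netGraph c} :=
    ⟨netColoring, isStarEdgeColoring_netColoring⟩
  refine le_antisymm (Nat.sInf_le hmem) (le_csInf ⟨4, hmem⟩ ?_)
  rintro k ⟨c, hc⟩
  exact four_le_of_isStarEdgeColoring_netGraph hc
end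

section
/- For every odd integer h ≥ 1, the star chromatic index of the necklace N_h satisfies 4 ≤ χ'_star(N_h) ≤ 5. -/
/-- The adjacency relation of the necklace `N_h`.  `Sum.inl i` is the spine
vertex `s_{i+1}` (for `0 ≤ i ≤ h-1`) and `Sum.inr j` is the cycle vertex `ℓ_j`
(for `0 ≤ j ≤ h+1`).  Edges: spine edges `s_i s_{i+1}`, the tree edges
`s_1 ℓ_0`, `s_h ℓ_{h+1}`, `s_i ℓ_i`, and the cycle edges
`ℓ_0 ℓ_1, …, ℓ_h ℓ_{h+1}, ℓ_{h+1} ℓ_0`. -/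
def necklaceRel (h : ℕ) : (Fin h ⊕ Fin (h + 2)) → (Fin h ⊕ Fin (h + 2)) → Prop
  | Sum.inl i, Sum.inl j => (j : ℕ) = (i : ℕ) + 1
  | Sum.inl i, Sum.inr j =>
      ((i : ℕ) = 0 ∧ (j : ℕ) = 0) ∨ ((i : ℕ) + 1 = h ∧ (j : ℕ) = h + 1) ∨
        ((j : ℕ) = (i : ℕ) + 1)
  | Sum.inr i, Sum.inr j => (j : ℕ) = ((i : ℕ) + 1) % (h + 2)
  | Sum.inr _, Sum.inl _ => False

/-- The necklace `N_h`, a cubic Halin graph on `2h + 2` vertices. -/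
def necklace (h : ℕ) : SimpleGraph (Fin h ⊕ Fin (h + 2)) :=
  SimpleGraph.fromRel (necklaceRel h)

/-- A graph with a vertex in which every vertex has at least three neighbors has no star
edge-coloring with fewer than four colors: three colors would all occur at every vertex, so
a two-colored walk could be continued indefinitely. -/
theorem IsStarEdgeColoring.four_le {V : Type*} [Nonempty V] {G : SimpleGraph V}
    (hG : ∀ v, ∃ a b d, G.Adj v a ∧ G.Adj v b ∧ G.Adj v d ∧ a ≠ b ∧ a ≠ d ∧ b ≠ d)
    {k : ℕ} {c : Sym2 V → Fin k} (hc : IsStarEdgeColoring G c) : 4 ≤ k := by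
  obtain ⟨hproper, hstar⟩ := hc
  by_contra! hk
  have hsurj (v : V) (x : Fin k) : ∃ w, G.Adj v w ∧ c s(v, w) = x := by
    obtain ⟨a, b, d, ha, hb, hd, hab, had, hbd⟩ := hG v
    have h₁ := hproper ha hb hab
    have h₂ := hproper ha hd had
    have h₃ := hproper hb hd hbd
    by_contra! hx
    have hxa := hx a ha
    have hxb := hx b hb
    have hxd := hx d hd
    simp only [ne_eq, Fin.ext_iff] at *
    omega
  obtain ⟨v₁⟩ := ‹Nonempty V›
  obtain ⟨v₀, v₂, -, h₁₀, h₁₂, -, h₀₂, -⟩ := hG v₁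
  obtain ⟨v₃, h₂₃, hc₃⟩ := hsurj v₂ (c s(v₁, v₀))
  obtain ⟨v₄, h₃₄, hc₄⟩ := hsurj v₃ (c s(v₁, v₂))
  have hne := hproper h₁₀ h₁₂ h₀₂
  have swap (u v : V) : c s(u, v) = c s(v, u) := by rw [Sym2.eq_swap]
  refine hstar v₀ v₁ v₂ v₃ v₄ h₁₀.symm h₁₂ h₂₃ h₃₄ h₀₂ ?_ ?_ ?_ ?_
    ⟨by rw [swap, hc₃], hc₄.symm⟩
  · rintro rfl
    exact hproper h₁₀.symm h₂₃.symm h₁₂.ne (by rw [swap, ← hc₃, swap])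
  · rintro rfl
    exact hne (by rw [← hc₃, swap])
  · rintro rfl
    exact hproper h₁₂ h₃₄.symm h₂₃.ne (by rw [← hc₄, swap])
  · rintro rfl
    exact hne (by rw [← hc₃, ← hc₄, swap])

theorem necklace_adj_inl_inl {h : ℕ} {i j : Fin h} :
    (necklace h).Adj (Sum.inl i) (Sum.inl j) ↔ (j : ℕ) = i + 1 ∨ (i : ℕ) = j + 1 := by
  simp only [necklace, SimpleGraph.fromRel_adj, necklaceRel, ne_eq, Sum.inl.injEq, Fin.ext_iff]
  omega

theorem necklace_adj_inl_inr {h : ℕ} {i : Fin h} {j : Fin (h + 2)} :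
    (necklace h).Adj (Sum.inl i) (Sum.inr j) ↔
      ((i : ℕ) = 0 ∧ (j : ℕ) = 0) ∨ ((i : ℕ) + 1 = h ∧ (j : ℕ) = h + 1) ∨ (j : ℕ) = i + 1 := by
  simp [necklace, necklaceRel]

theorem necklace_adj_inr_inl {h : ℕ} {i : Fin h} {j : Fin (h + 2)} :
    (necklace h).Adj (Sum.inr j) (Sum.inl i) ↔
      ((i : ℕ) = 0 ∧ (j : ℕ) = 0) ∨ ((i : ℕ) + 1 = h ∧ (j : ℕ) = h + 1) ∨ (j : ℕ) = i + 1 := by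
  rw [SimpleGraph.adj_comm, necklace_adj_inl_inr]

theorem necklace_adj_inr_inr {h : ℕ} {i j : Fin (h + 2)} :
    (necklace h).Adj (Sum.inr i) (Sum.inr j) ↔
      (j : ℕ) = i + 1 ∨ (i : ℕ) = j + 1 ∨ ((i : ℕ) = 0 ∧ (j : ℕ) = h + 1) ∨
        ((j : ℕ) = 0 ∧ (i : ℕ) = h + 1) := by
  have hmod (i : Fin (h + 2)) :
      ((i : ℕ) + 1) % (h + 2) = if (i : ℕ) = h + 1 then 0 else (i : ℕ) + 1 := by
    split_ifs with hi
    · simp [hi]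
    · exact Nat.mod_eq_of_lt (by omega)
  simp only [necklace, SimpleGraph.fromRel_adj, necklaceRel, hmod, ne_eq, Sum.inr.injEq,
    Fin.ext_iff]
  split_ifs <;> omega

theorem necklace_exists_three_neighbors {h : ℕ} (h1 : 1 ≤ h) (v : Fin h ⊕ Fin (h + 2)) :
    ∃ a b d, (necklace h).Adj v a ∧ (necklace h).Adj v b ∧ (necklace h).Adj v d ∧
      a ≠ b ∧ a ≠ d ∧ b ≠ d := by
  obtain ⟨i, hi⟩ | ⟨j, hj⟩ := v
  · obtain ⟨a, ha, hca⟩ : ∃ a, (necklace h).Adj (Sum.inl ⟨i, hi⟩) a ∧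
        (a = Sum.inr 0 ∨ ∃ t : Fin h, a = Sum.inl t ∧ (t : ℕ) < i) := by
      by_cases h0 : i = 0
      · exact ⟨_, by simp [necklace_adj_inl_inr, h0], Or.inl rfl⟩
      · exact ⟨Sum.inl ⟨i - 1, by omega⟩, by simp [necklace_adj_inl_inl]; omega,
          Or.inr ⟨_, rfl, by simp; omega⟩⟩
    obtain ⟨b, hb, hcb⟩ : ∃ b, (necklace h).Adj (Sum.inl ⟨i, hi⟩) b ∧
        (b = Sum.inr (Fin.last _) ∨ ∃ t : Fin h, b = Sum.inl t ∧ i < (t : ℕ)) := by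
      by_cases h0 : i + 1 = h
      · exact ⟨_, by simp [necklace_adj_inl_inr, h0], Or.inl rfl⟩
      · exact ⟨Sum.inl ⟨i + 1, by omega⟩, by simp [necklace_adj_inl_inl],
          Or.inr ⟨_, rfl, by simp⟩⟩
    refine ⟨a, b, Sum.inr ⟨i + 1, by omega⟩, ha, hb, by simp [necklace_adj_inl_inr], ?_⟩
    obtain rfl | ⟨t, rfl, ht⟩ := hca <;> obtain rfl | ⟨t', rfl, ht'⟩ := hcb <;>
      simp [Fin.ext_iff] <;> omega
  · by_cases h0 : j = 0
    · refine ⟨Sum.inr ⟨1, by omega⟩, Sum.inr (Fin.last _), Sum.inl ⟨0, h1⟩, ?_⟩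
      simp [necklace_adj_inr_inr, necklace_adj_inr_inl, Fin.ext_iff, h0]
      omega
    by_cases hl : j = h + 1
    · refine ⟨Sum.inr 0, Sum.inr ⟨h, by omega⟩, Sum.inl ⟨h - 1, by omega⟩, ?_⟩
      simp [necklace_adj_inr_inr, necklace_adj_inr_inl, Fin.ext_iff, hl]
      omega
    · refine ⟨Sum.inr ⟨j - 1, by omega⟩, Sum.inr ⟨j + 1, by omega⟩, Sum.inl ⟨j - 1, by omega⟩, ?_⟩
      simp [necklace_adj_inr_inr, necklace_adj_inr_inl, Fin.ext_iff]
      omega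

/-- The position modulo 4 of a vertex on the Hamiltonian cycle
`ℓ_0 s_1 … s_h ℓ_{h+1} ℓ_h … ℓ_1` of the necklace, whose length `2h + 2` is divisible by 4
for odd `h`. -/
def necklacePos (h : ℕ) : Fin h ⊕ Fin (h + 2) → Fin 4
  | Sum.inl i => Fin.ofNat 4 (i + 1)
  | Sum.inr j => Fin.ofNat 4 (3 * j)

/-- The color of an edge with endpoints at positions `x` and `y` modulo 4.  Edges of the
Hamiltonian cycle join positions of different parity and receive the colors `0, 1, 0, 2`
periodically; chords join positions of the same parity, which determines their color. -/
def necklaceColor (x y : Fin 4) : Fin 5 :=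
  if (x + y : ℕ) % 2 = 0 then (if (x : ℕ) % 2 = 0 then 3 else 4)
  else if (x + y : ℕ) = 3 ∧ (x * y : ℕ) = 0 then 2
  else if (x + y : ℕ) = 3 then 1
  else 0

theorem necklacePos_injOn_neighbors {h : ℕ} (hodd : Odd h) {u v w : Fin h ⊕ Fin (h + 2)}
    (huv : (necklace h).Adj u v) (huw : (necklace h).Adj u w) (hvw : v ≠ w) :
    necklacePos h v ≠ necklacePos h w ∧
      ¬((necklacePos h u + necklacePos h v : ℕ) % 2 = 0 ∧
        (necklacePos h u + necklacePos h w : ℕ) % 2 = 0) := by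
  obtain ⟨m, rfl⟩ := hodd
  obtain u | u := u <;> obtain v | v := v <;> obtain w | w := w <;>
    simp only [necklace_adj_inl_inl, necklace_adj_inl_inr, necklace_adj_inr_inl,
      necklace_adj_inr_inr, necklacePos, Fin.ofNat, Fin.ext_iff, ne_eq, Sum.inl.injEq,
      Sum.inr.injEq, reduceCtorEq, not_false_eq_true] at * <;>
    omega

/-- The star 5-edge-coloring of the necklace given by `necklaceColor`. -/
def necklaceColoring (h : ℕ) (e : Sym2 (Fin h ⊕ Fin (h + 2))) : Fin 5 :=
  Sym2.lift ⟨necklaceColor, by decide⟩ (e.map (necklacePos h))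

theorem isStarEdgeColoring_necklaceColoring {h : ℕ} (hodd : Odd h) :
    IsStarEdgeColoring (necklace h) (necklaceColoring h) := by
  refine ⟨fun u v w huv huw hvw ↦ ?_, fun v₀ v₁ v₂ v₃ v₄ h₀₁ h₁₂ h₂₃ h₃₄ n₀₂ _ n₁₃ _ n₂₄ ↦ ?_⟩
  · have key : ∀ x y z : Fin 4, y ≠ z → ¬((x + y : ℕ) % 2 = 0 ∧ (x + z : ℕ) % 2 = 0) →
        necklaceColor x y ≠ necklaceColor x z := by decide
    obtain ⟨hne, hpar⟩ := necklacePos_injOn_neighbors hodd huv huw hvw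
    exact key _ _ _ hne hpar
  · have key : ∀ x₀ x₁ x₂ : Fin 4, x₀ ≠ x₂ →
        ¬((x₁ + x₀ : ℕ) % 2 = 0 ∧ (x₁ + x₂ : ℕ) % 2 = 0) →
        ∀ x₃, x₁ ≠ x₃ → ¬((x₂ + x₁ : ℕ) % 2 = 0 ∧ (x₂ + x₃ : ℕ) % 2 = 0) →
        ∀ x₄, x₂ ≠ x₄ → ¬((x₃ + x₂ : ℕ) % 2 = 0 ∧ (x₃ + x₄ : ℕ) % 2 = 0) →
        ¬(necklaceColor x₀ x₁ = necklaceColor x₂ x₃ ∧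
          necklaceColor x₁ x₂ = necklaceColor x₃ x₄) := by decide
    obtain ⟨hne₁, hpar₁⟩ := necklacePos_injOn_neighbors hodd h₀₁.symm h₁₂ n₀₂
    obtain ⟨hne₂, hpar₂⟩ := necklacePos_injOn_neighbors hodd h₁₂.symm h₂₃ n₁₃
    obtain ⟨hne₃, hpar₃⟩ := necklacePos_injOn_neighbors hodd h₂₃.symm h₃₄ n₂₄
    exact key _ _ _ hne₁ hpar₁ _ hne₂ hpar₂ _ hne₃ hpar₃

/-- For every odd `h ≥ 1`, the star chromatic index of the necklace `N_h`
satisfies `4 ≤ χ'_star(N_h) ≤ 5`. -/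
theorem starChromaticIndex_necklace_odd (h : ℕ) (h1 : 1 ≤ h) (hodd : Odd h) :
    4 ≤ starChromaticIndex (necklace h) ∧ starChromaticIndex (necklace h) ≤ 5 := by
  have hmem := isStarEdgeColoring_necklaceColoring hodd
  refine ⟨le_csInf ⟨5, _, hmem⟩ ?_, Nat.sInf_le ⟨_, hmem⟩⟩
  rintro k ⟨c, hc⟩
  exact hc.four_le (necklace_exists_three_neighbors h1)
end

section
/- For every even integer n ≥ 4, the star chromatic index of the square of the cycle on n vertices satisfies χ'_star(C_n²) ≤ 9. -/
/-- The square `Cₙ²` of the cycle on `n` vertices: vertices `ZMod n`, with `i`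
adjacent to `j` iff `i ≠ j` and `i - j ≡ ±1` or `±2 (mod n)`. -/
def cycleSq (n : ℕ) : SimpleGraph (ZMod n) :=
  SimpleGraph.fromRel (fun a b => a - b = 1 ∨ a - b = 2)

/-- Along a non-backtracking walk with steps `±d`, the colors of four consecutive edges
do not alternate. -/
theorem not_bicolored_of_step {A C : Type*} [AddCommGroup A] {c : Sym2 A → C} {d : A} {g : A → C}
    (hc : ∀ i, c s(i, i + d) = g i)
    (hg : ∀ i, ¬(g i = g (i + d + d) ∧ g (i + d) = g (i + d + d + d)))
    {v₀ v₁ v₂ v₃ v₄ : A}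
    (h₀ : v₁ = v₀ + d ∨ v₀ = v₁ + d) (h₁ : v₂ = v₁ + d ∨ v₁ = v₂ + d)
    (h₂ : v₃ = v₂ + d ∨ v₂ = v₃ + d) (h₃ : v₄ = v₃ + d ∨ v₃ = v₄ + d)
    (h₀₂ : v₀ ≠ v₂) (h₁₃ : v₁ ≠ v₃) (h₂₄ : v₂ ≠ v₄) :
    ¬(c s(v₀, v₁) = c s(v₂, v₃) ∧ c s(v₁, v₂) = c s(v₃, v₄)) := by
  have hc' : ∀ i, c s(i + d, i) = g i := fun i => by rw [Sym2.eq_swap, hc]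
  rcases h₀ with rfl | rfl
  · rcases h₁ with rfl | h₁
    · rcases h₂ with rfl | h₂
      · rcases h₃ with rfl | h₃
        · simpa only [hc] using hg v₀
        · exact absurd (add_right_cancel h₃) h₂₄
      · exact absurd (add_right_cancel h₂) h₁₃
    · exact absurd (add_right_cancel h₁) h₀₂
  · rcases h₁ with rfl | rfl
    · exact absurd rfl h₀₂
    · rcases h₂ with rfl | rfl
      · exact absurd rfl h₁₃
      · rcases h₃ with rfl | rfl
        · exact absurd rfl h₂₄
        · simp only [hc']
          exact fun h => hg v₄ ⟨h.2.symm, h.1.symm⟩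

/-- Two distinct edges with steps `±d` at a common vertex have different colors. -/
theorem color_ne_of_step {A C : Type*} [AddCommGroup A] {c : Sym2 A → C} {d : A} {g : A → C}
    (hc : ∀ i, c s(i, i + d) = g i) (hg : ∀ i, g i ≠ g (i + d)) {u v w : A}
    (hv : v = u + d ∨ u = v + d) (hw : w = u + d ∨ u = w + d) (hvw : v ≠ w) :
    c s(u, v) ≠ c s(u, w) := by
  have hc' : ∀ i, c s(i + d, i) = g i := fun i => by rw [Sym2.eq_swap, hc]
  rcases hv with rfl | rfl
  · rcases hw with rfl | rfl
    · exact absurd rfl hvw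
    · simpa only [hc, hc'] using (hg w).symm
  · rcases hw with rfl | hw
    · simpa only [hc, hc'] using hg v
    · exact absurd (add_right_cancel hw) hvw

theorem ZMod.natCast_ne_zero_of_lt {n a : ℕ} (h0 : 0 < a) (h : a < n) : (a : ZMod n) ≠ 0 := by
  rw [Ne, ZMod.natCast_eq_zero_iff]
  exact Nat.not_dvd_of_pos_of_lt h0 h

/-- For `n ≥ 5` the edges `{i, i + 1}` and `{i, i + 2}` can be colored independently. -/
theorem exists_edge_function {n : ℕ} (hn : 5 ≤ n) {C : Type*} (h e : ZMod n → C) :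
    ∃ c : Sym2 (ZMod n) → C, (∀ i, c s(i, i + 1) = h i) ∧ ∀ i, c s(i, i + 2) = e i := by
  have h1 : (1 : ZMod n) ≠ 0 := by
    simpa using ZMod.natCast_ne_zero_of_lt (n := n) (a := 1) (by omega) (by omega)
  have h2 : (2 : ZMod n) ≠ 0 := by
    simpa using ZMod.natCast_ne_zero_of_lt (n := n) (a := 2) (by omega) (by omega)
  have h3 : (3 : ZMod n) ≠ 0 := by
    simpa using ZMod.natCast_ne_zero_of_lt (n := n) (a := 3) (by omega) (by omega)
  have h4 : (4 : ZMod n) ≠ 0 := by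
    simpa using ZMod.natCast_ne_zero_of_lt (n := n) (a := 4) (by omega) (by omega)
  have inj1 : Function.Injective fun i : ZMod n => s(i, i + 1) := by
    intro i j hij
    rcases Sym2.eq_iff.1 hij with hij | hij
    · exact hij.1
    · exact absurd (by linear_combination hij.2 - hij.1) h2
  have inj2 : Function.Injective fun i : ZMod n => s(i, i + 2) := by
    intro i j hij
    rcases Sym2.eq_iff.1 hij with hij | hij
    · exact hij.1
    · exact absurd (by linear_combination hij.2 - hij.1) h4
  refine ⟨Function.extend (fun i => s(i, i + 1)) h
    (Function.extend (fun i => s(i, i + 2)) e fun _ => h 0),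
    fun i => inj1.extend_apply _ _ i, fun i => ?_⟩
  rw [Function.extend_apply', inj2.extend_apply]
  rintro ⟨j, hj⟩
  rcases Sym2.eq_iff.1 hj with hj | hj
  · exact h1 (by linear_combination hj.1 - hj.2)
  · exact h3 (by linear_combination hj.2 - hj.1)

theorem cycleSq_adj {n : ℕ} {u v : ZMod n} (huv : (cycleSq n).Adj u v) :
    (v = u + 1 ∨ u = v + 1) ∨ (v = u + 2 ∨ u = v + 2) := by
  rcases huv with ⟨-, (h | h) | (h | h)⟩ <;> rw [sub_eq_iff_eq_add'] at h <;> simp [h, add_comm]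

/-- Star edge colorings of the Hamiltonian cycle and of the two cycles formed by the chords,
with disjoint color sets, combine to a star edge coloring of `Cₙ²`. -/
theorem exists_isStarEdgeColoring_cycleSq {n k : ℕ} (hn : 5 ≤ n) (h2 : 2 ∣ n)
    (h e : ZMod n → Fin k)
    (hh1 : ∀ i, h i ≠ h (i + 1))
    (hh2 : ∀ i, ¬(h i = h (i + 1 + 1) ∧ h (i + 1) = h (i + 1 + 1 + 1)))
    (he1 : ∀ i, e i ≠ e (i + 2))
    (he2 : ∀ i, ¬(e i = e (i + 2 + 2) ∧ e (i + 2) = e (i + 2 + 2 + 2)))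
    (hhe : ∀ i j, h i ≠ e j)
    (hpar : ∀ i j, e i = e j → ZMod.castHom h2 (ZMod 2) i = ZMod.castHom h2 (ZMod 2) j) :
    ∃ c : Sym2 (ZMod n) → Fin k, IsStarEdgeColoring (cycleSq n) c := by
  obtain ⟨c, hc1, hc2⟩ := exists_edge_function hn h e
  have two : (2 : ZMod 2) = 0 := by decide
  have hH : ∀ {u v}, (v = u + 1 ∨ u = v + 1) → ∃ i, c s(u, v) = h i := by
    rintro u v (rfl | rfl)
    · exact ⟨_, hc1 _⟩
    · exact ⟨_, by rw [Sym2.eq_swap, hc1]⟩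
  have hE : ∀ {u v}, (v = u + 2 ∨ u = v + 2) → ∃ i, c s(u, v) = e i ∧
      ZMod.castHom h2 (ZMod 2) i = ZMod.castHom h2 (ZMod 2) u ∧
      ZMod.castHom h2 (ZMod 2) i = ZMod.castHom h2 (ZMod 2) v := by
    rintro u v (rfl | rfl)
    · exact ⟨_, hc2 _, rfl, by rw [map_add, map_ofNat, two, add_zero]⟩
    · exact ⟨_, by rw [Sym2.eq_swap, hc2], by rw [map_add, map_ofNat, two, add_zero], rfl⟩
  have hHE : ∀ {u v u' v'}, (v = u + 1 ∨ u = v + 1) → (v' = u' + 2 ∨ u' = v' + 2) →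
      c s(u, v) ≠ c s(u', v') := by
    intro u v u' v' h₁ h₂
    obtain ⟨i, hi⟩ := hH h₁
    obtain ⟨j, hj, -⟩ := hE h₂
    rw [hi, hj]
    exact hhe i j
  have hEHE : ∀ {u v v' u'}, (v = u + 2 ∨ u = v + 2) → (v' = v + 1 ∨ v = v' + 1) →
      (u' = v' + 2 ∨ v' = u' + 2) → c s(u, v) ≠ c s(v', u') := by
    intro u v v' u' h₁ h₂ h₃ heq
    obtain ⟨i, hi, -, hi'⟩ := hE h₁
    obtain ⟨j, hj, hj', -⟩ := hE h₃
    rw [hi, hj] at heq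
    have key := hpar i j heq
    rw [hi', hj'] at key
    rcases h₂ with rfl | rfl <;> rw [map_add, map_one] at key <;> simp at key
  refine ⟨c, fun u v w huv huw hvw => ?_, fun v₀ v₁ v₂ v₃ v₄ a₀ a₁ a₂ a₃ n₀₂ _ n₁₃ _ n₂₄ => ?_⟩
  · rcases cycleSq_adj huv with b₀ | b₀ <;> rcases cycleSq_adj huw with b₁ | b₁
    · exact color_ne_of_step hc1 hh1 b₀ b₁ hvw
    · exact hHE b₀ b₁
    · exact (hHE b₁ b₀).symm
    · exact color_ne_of_step hc2 he1 b₀ b₁ hvw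
  · rcases cycleSq_adj a₀ with b₀ | b₀ <;> rcases cycleSq_adj a₂ with b₂ | b₂
    · rcases cycleSq_adj a₁ with b₁ | b₁ <;> rcases cycleSq_adj a₃ with b₃ | b₃
      · exact not_bicolored_of_step hc1 hh2 b₀ b₁ b₂ b₃ n₀₂ n₁₃ n₂₄
      · exact fun H => hHE b₁ b₃ H.2
      · exact fun H => hHE b₃ b₁ H.2.symm
      · exact fun H => hEHE b₁ b₂ b₃ H.2
    · exact fun H => hHE b₀ b₂ H.1
    · exact fun H => hHE b₂ b₀ H.1.symm
    · rcases cycleSq_adj a₁ with b₁ | b₁ <;> rcases cycleSq_adj a₃ with b₃ | b₃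
      · exact fun H => hEHE b₀ b₁ b₂ H.1
      · exact fun H => hHE b₁ b₃ H.2
      · exact fun H => hHE b₃ b₁ H.2.symm
      · exact not_bicolored_of_step hc2 he2 b₀ b₁ b₂ b₃ n₀₂ n₁₃ n₂₄

/-- A cyclic word of length `m ∉ {1, 2, 5}` over `{0, 1, 2}` made of `m % 3` blocks `0121`
followed by blocks `012`. -/
def cyclicWord (m x : ℕ) : ℕ :=
  if x < 4 * (m % 3) then (if x % 4 = 3 then 1 else x % 4) else (x - 4 * (m % 3)) % 3

/-- The successor of `x` among `0, …, m - 1` in cyclic order. -/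
def cyclicSucc (m x : ℕ) : ℕ := if x + 1 = m then 0 else x + 1

theorem cyclicWord_lt (m x : ℕ) : cyclicWord m x < 3 := by
  unfold cyclicWord
  split_ifs <;> omega

theorem cyclicWord_ne {m : ℕ} (hm : 3 ≤ m) (h5 : m ≠ 5) (x : ℕ) :
    cyclicWord m x ≠ cyclicWord m (cyclicSucc m x) := by
  unfold cyclicWord cyclicSucc
  split_ifs <;> first | contradiction | omega

theorem cyclicWord_not_alternating {m : ℕ} (hm : 3 ≤ m) (h5 : m ≠ 5) (x : ℕ) :
    ¬(cyclicWord m x = cyclicWord m (cyclicSucc m (cyclicSucc m x)) ∧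
      cyclicWord m (cyclicSucc m x) =
        cyclicWord m (cyclicSucc m (cyclicSucc m (cyclicSucc m x)))) := by
  obtain ⟨k, r, hr, rfl⟩ : ∃ k r, r < 3 ∧ m = 3 * k + r := ⟨m / 3, m % 3, by omega, by omega⟩
  have hmod : (3 * k + r) % 3 = r := by omega
  unfold cyclicWord
  rw [hmod]
  generalize e1 : cyclicSucc (3 * k + r) x = y
  generalize e2 : cyclicSucc (3 * k + r) y = z
  generalize e3 : cyclicSucc (3 * k + r) z = w
  unfold cyclicSucc at e1 e2 e3
  interval_cases r <;> grind

theorem ZMod.val_add_one_eq_cyclicSucc {n : ℕ} (hn : 2 ≤ n) (i : ZMod n) :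
    (i + 1).val = cyclicSucc n i.val := by
  have : NeZero n := ⟨by omega⟩
  have : Fact (1 < n) := ⟨by omega⟩
  have := i.val_lt
  rw [ZMod.val_add, ZMod.val_one]
  unfold cyclicSucc
  split_ifs with hi
  · rw [hi, Nat.mod_self]
  · exact Nat.mod_eq_of_lt (by omega)

theorem ZMod.val_add_two_of_even {m : ℕ} (hm : 2 ≤ m) (i : ZMod (2 * m)) :
    (i + 2).val / 2 = cyclicSucc m (i.val / 2) ∧ (i + 2).val % 2 = i.val % 2 := by
  have : NeZero (2 * m) := ⟨by omega⟩
  have := i.val_lt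
  rw [show i + 2 = i + 1 + 1 by ring, ZMod.val_add_one_eq_cyclicSucc (by omega),
    ZMod.val_add_one_eq_cyclicSucc (by omega)]
  unfold cyclicSucc
  split_ifs <;> omega

theorem exists_isStarEdgeColoring_cycleSq_two_mul {m : ℕ} (hm : 3 ≤ m) (h5 : m ≠ 5) :
    ∃ c : Sym2 (ZMod (2 * m)) → Fin 9, IsStarEdgeColoring (cycleSq (2 * m)) c := by
  have : NeZero (2 * m) := ⟨by omega⟩
  have hW := cyclicWord_lt
  refine exists_isStarEdgeColoring_cycleSq (by omega) (Dvd.intro m rfl)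
    (fun i => ⟨cyclicWord (2 * m) i.val, (hW _ _).trans (by omega)⟩)
    (fun i => ⟨3 + 3 * (i.val % 2) + cyclicWord m (i.val / 2), by
      have := hW m (i.val / 2)
      omega⟩) ?_ ?_ ?_ ?_ ?_ ?_
  · intro i
    simpa [ZMod.val_add_one_eq_cyclicSucc (show 2 ≤ 2 * m by omega)] using
      cyclicWord_ne (by omega) (by omega) i.val
  · intro i
    simp only [Fin.mk.injEq, ZMod.val_add_one_eq_cyclicSucc (show 2 ≤ 2 * m by omega)]
    exact cyclicWord_not_alternating (by omega) (by omega) i.val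
  · intro i
    simpa [ZMod.val_add_two_of_even (show 2 ≤ m by omega)] using cyclicWord_ne hm h5 (i.val / 2)
  · intro i
    simpa [ZMod.val_add_two_of_even (show 2 ≤ m by omega)] using
      cyclicWord_not_alternating hm h5 (i.val / 2)
  · intro i j hij
    have := hW (2 * m) i.val
    simp only [Fin.mk.injEq] at hij
    omega
  · intro i j hij
    have := hW m (i.val / 2)
    have := hW m (j.val / 2)
    simp only [Fin.mk.injEq] at hij
    rw [ZMod.castHom_apply, ZMod.castHom_apply, ← ZMod.natCast_val, ← ZMod.natCast_val,
      ZMod.natCast_eq_natCast_iff']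
    omega

/-- On `K₄ = C₄²` any injective edge coloring is a star edge coloring. -/
theorem exists_isStarEdgeColoring_cycleSq_four :
    ∃ c : Sym2 (ZMod 4) → Fin 9, IsStarEdgeColoring (cycleSq 4) c := by
  refine ⟨Sym2.lift ⟨fun u v : Fin 4 => Fin.ofNat 9
    (if u = 0 ∨ v = 0 then u.val + v.val else u.val + v.val + 1), by decide⟩, ?_, ?_⟩
  · have key : ∀ u v w : Fin 4, u ≠ v → u ≠ w → v ≠ w →
        Fin.ofNat 9 (if u = 0 ∨ v = 0 then u.val + v.val else u.val + v.val + 1) ≠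
          Fin.ofNat 9 (if u = 0 ∨ w = 0 then u.val + w.val else u.val + w.val + 1) := by
      decide
    exact fun u v w huv huw hvw => key u v w huv.ne huw.ne hvw
  · have key : ∀ u v w x : Fin 4, u ≠ v → v ≠ w → w ≠ x → u ≠ w → u ≠ x → v ≠ x →
        Fin.ofNat 9 (if u = 0 ∨ v = 0 then u.val + v.val else u.val + v.val + 1) ≠
          Fin.ofNat 9 (if w = 0 ∨ x = 0 then w.val + x.val else w.val + x.val + 1) := by
      decide
    exact fun u v w x _ huv hvw hwx _ huw hux hvx _ _ h =>
      key u v w x huv.ne hvw.ne hwx.ne huw hux hvx h.1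

/-- A symmetric table of colors for the edges of `C₁₀²`. -/
def cycleSqTenColor (u v : Fin 10) : Fin 9 :=
  let h : Fin 10 → Fin 9 := ![0, 2, 5, 6, 0, 2, 5, 7, 8, 2]
  let e : Fin 10 → Fin 9 := ![1, 3, 3, 1, 4, 3, 6, 6, 3, 4]
  if v = u + 1 then h u else if u = v + 1 then h v else
  if v = u + 2 then e u else if u = v + 2 then e v else 0

theorem exists_isStarEdgeColoring_cycleSq_ten :
    ∃ c : Sym2 (ZMod 10) → Fin 9, IsStarEdgeColoring (cycleSq 10) c := by
  let A : Fin 10 → Fin 10 → Prop := fun u v => (v = u + 1 ∨ u = v + 1) ∨ (v = u + 2 ∨ u = v + 2)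
  have symm : ∀ u v, cycleSqTenColor u v = cycleSqTenColor v u := by decide +kernel
  have proper : ∀ u v, A u v → ∀ w, A u w → v ≠ w →
      cycleSqTenColor u v ≠ cycleSqTenColor u w := by
    decide +kernel
  have star : ∀ v₀ v₁, A v₀ v₁ → ∀ v₂, A v₁ v₂ → v₀ ≠ v₂ → ∀ v₃, A v₂ v₃ → v₀ ≠ v₃ → v₁ ≠ v₃ →
      cycleSqTenColor v₀ v₁ = cycleSqTenColor v₂ v₃ → ∀ v₄, A v₃ v₄ → v₁ ≠ v₄ → v₂ ≠ v₄ →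
      cycleSqTenColor v₁ v₂ ≠ cycleSqTenColor v₃ v₄ := by
    decide +kernel
  exact ⟨Sym2.lift ⟨cycleSqTenColor, symm⟩,
    fun u v w huv huw hvw => proper u v (cycleSq_adj huv) w (cycleSq_adj huw) hvw,
    fun v₀ v₁ v₂ v₃ v₄ a₀ a₁ a₂ a₃ n₀₂ n₀₃ n₁₃ n₁₄ n₂₄ h =>
      star v₀ v₁ (cycleSq_adj a₀) v₂ (cycleSq_adj a₁) n₀₂ v₃ (cycleSq_adj a₂) n₀₃ n₁₃ h.1
        v₄ (cycleSq_adj a₃) n₁₄ n₂₄ h.2⟩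

/-- For every even `n ≥ 4`, `χ'_star(Cₙ²) ≤ 9`. -/
theorem starChromaticIndex_cycleSq_even (n : ℕ) (h4 : 4 ≤ n) (heven : Even n) :
    starChromaticIndex (cycleSq n) ≤ 9 := by
  apply Nat.sInf_le
  obtain ⟨m, rfl⟩ := heven.two_dvd
  rcases eq_or_ne m 2 with rfl | h2
  · exact exists_isStarEdgeColoring_cycleSq_four
  rcases eq_or_ne m 5 with rfl | h5
  · exact exists_isStarEdgeColoring_cycleSq_ten
  · exact exists_isStarEdgeColoring_cycleSq_two_mul (by omega) h5
end

section
/- For every odd integer n ≥ 3 with n ≠ 5 and n ≠ 11, the star chromatic index of the square of the cycle on n vertices satisfies χ'_star(C_n²) ≤ 8. -/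
/-- The colors of the edges `{i, i + 1}` and `{i, i + 2}` assigned to the vertex `i`. -/
abbrev ColorPair := Fin 8 × Fin 8

namespace CycleSq

/-- The neighbors of `p ≥ 2` in the square of the infinite path. -/
def nbrs (p : ℕ) : List ℕ := [p - 2, p - 1, p + 1, p + 2]

/-- The color of the edge `{p, q}` inside a window `l` of consecutive color pairs. -/
def windowColor (l : List ColorPair) (p q : ℕ) : Fin 8 :=
  if q = p + 1 then (l.getD p 0).1 else
  if p = q + 1 then (l.getD q 0).1 else
  if q = p + 2 then (l.getD p 0).2 else (l.getD q 0).2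

/-- In the window `l` of eight consecutive color pairs, the coloring is proper at the central
vertex `4` and no walk with four edges centered there is forbidden. -/
def GoodWindow (l : List ColorPair) : Prop :=
  (∀ p ∈ nbrs 4, ∀ q ∈ nbrs 4, p ≠ q → windowColor l 4 p ≠ windowColor l 4 q) ∧
  (∀ p ∈ nbrs 4, ∀ q ∈ nbrs 4, p ≠ q → ∀ r ∈ nbrs p, r ≠ 4 → r ≠ q →
    windowColor l r p = windowColor l 4 q → ∀ t ∈ nbrs q, t ≠ 4 → t ≠ p →
    windowColor l p 4 ≠ windowColor l q t)

instance : DecidablePred GoodWindow := fun _ => inferInstanceAs (Decidable (_ ∧ _))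

section Coloring

variable {n : ℕ}

lemma natCast_ne_zero_of_lt {m : ℕ} (hm : 0 < m) (hmn : m < n) : (m : ZMod n) ≠ 0 := by
  rw [Ne, ZMod.natCast_eq_zero_iff]
  exact Nat.not_dvd_of_pos_of_lt hm hmn

/-- The color of the pair `{x, y}` under the assignment `t` of color pairs to vertices. -/
def pairColor (t : ZMod n → ColorPair) (x y : ZMod n) : Fin 8 :=
  if y = x + 1 then (t x).1 else
  if x = y + 1 then (t y).1 else
  if y = x + 2 then (t x).2 else if x = y + 2 then (t y).2 else 0

lemma pairColor_comm (hn : 5 ≤ n) (t : ZMod n → ColorPair) (x y : ZMod n) :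
    pairColor t x y = pairColor t y x := by
  have h2 := natCast_ne_zero_of_lt (n := n) (m := 2) (by omega) (by omega)
  have h4 := natCast_ne_zero_of_lt (n := n) (m := 4) (by omega) (by omega)
  push_cast at h2 h4
  unfold pairColor
  split_ifs <;> first | rfl | (exfalso; grind)

/-- The edge coloring determined by an assignment of color pairs to vertices. -/
def edgeColor (hn : 5 ≤ n) (t : ZMod n → ColorPair) : Sym2 (ZMod n) → Fin 8 :=
  Sym2.lift ⟨pairColor t, pairColor_comm hn t⟩

/-- The color pairs at the eight consecutive vertices starting with `i`. -/
def window (t : ZMod n → ColorPair) (i : ZMod n) : List ColorPair :=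
  (List.range 8).map fun k => t (i + (k : ℕ))

lemma window_getD (t : ZMod n → ColorPair) (i : ZMod n) {p : ℕ} (hp : p < 8) :
    (window t i).getD p 0 = t (i + p) := by
  simp [window, List.getD, hp]

lemma pairColor_add_one (t : ZMod n → ColorPair) (x : ZMod n) :
    pairColor t x (x + 1) = (t x).1 :=
  if_pos rfl

lemma pairColor_add_two (hn : 5 ≤ n) (t : ZMod n → ColorPair) (x : ZMod n) :
    pairColor t x (x + 2) = (t x).2 := by
  have h1 := natCast_ne_zero_of_lt (n := n) (m := 1) (by omega) (by omega)
  have h3 := natCast_ne_zero_of_lt (n := n) (m := 3) (by omega) (by omega)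
  push_cast at h1 h3
  unfold pairColor
  rw [if_neg fun h => h1 (by linear_combination h), if_neg fun h => h3 (by linear_combination -h),
    if_pos rfl]

lemma edgeColor_window (hn : 5 ≤ n) (t : ZMod n → ColorPair) (i : ZMod n) {p q : ℕ}
    (hp : 2 ≤ p) (hp' : p ≤ 6) (hq : q ∈ nbrs p) :
    edgeColor hn t s(i + p, i + q) = windowColor (window t i) p q := by
  change pairColor t _ _ = _
  have hcases : p = q + 2 ∨ p = q + 1 ∨ q = p + 1 ∨ q = p + 2 := by
    simp only [nbrs, List.mem_cons, List.not_mem_nil, or_false] at hq; omega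
  rcases hcases with rfl | rfl | rfl | rfl
  · rw [windowColor, if_neg (by omega), if_neg (by omega), if_neg (by omega),
      window_getD t i (by omega), pairColor_comm hn, Nat.cast_add, ← add_assoc]
    exact pairColor_add_two hn t _
  · rw [windowColor, if_neg (by omega), if_pos rfl, window_getD t i (by omega),
      pairColor_comm hn, Nat.cast_add_one, ← add_assoc, pairColor_add_one]
  · rw [windowColor, if_pos rfl, window_getD t i (by omega), Nat.cast_add_one, ← add_assoc,
      pairColor_add_one]
  · rw [windowColor, if_neg (by omega), if_neg (by omega), if_pos rfl,
      window_getD t i (by omega), Nat.cast_add, ← add_assoc]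
    exact pairColor_add_two hn t _

lemma exists_mem_nbrs_of_adj {x y i : ZMod n} {p : ℕ} (hp : 2 ≤ p) (hx : x = i + p)
    (h : (cycleSq n).Adj x y) : ∃ q ∈ nbrs p, y = i + q := by
  simp only [cycleSq, SimpleGraph.fromRel_adj] at h
  obtain ⟨p, rfl⟩ := Nat.exists_eq_add_of_le' hp
  push_cast at hx
  simp only [nbrs, List.mem_cons, List.not_mem_nil, or_false, exists_eq_or_imp, exists_eq_left]
  rcases h.2 with (h | h) | (h | h)
  · right; left; push_cast [show p + 2 - 1 = p + 1 by omega]; grind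
  · left; push_cast [show p + 2 - 2 = p by omega]; grind
  · right; right; left; push_cast; grind
  · right; right; right; push_cast; grind

lemma nbrs_bounds {p : ℕ} (hp : p ∈ nbrs 4) : 2 ≤ p ∧ p ≤ 6 := by
  simp only [nbrs, List.mem_cons, List.not_mem_nil, or_false] at hp; omega

theorem isStarEdgeColoring_edgeColor (hn : 5 ≤ n) (t : ZMod n → ColorPair)
    (ht : ∀ i, GoodWindow (window t i)) :
    IsStarEdgeColoring (cycleSq n) (edgeColor hn t) := by
  constructor
  · intro u v w huv huw hvw
    obtain ⟨i, hu⟩ : ∃ i, u = i + (4 : ℕ) := ⟨u - (4 : ℕ), by ring⟩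
    obtain ⟨p, hp, rfl⟩ := exists_mem_nbrs_of_adj (by omega) hu huv
    obtain ⟨q, hq, rfl⟩ := exists_mem_nbrs_of_adj (by omega) hu huw
    subst hu
    rw [edgeColor_window hn t i (by omega) (by omega) hp,
      edgeColor_window hn t i (by omega) (by omega) hq]
    exact (ht i).1 p hp q hq fun h => hvw (by rw [h])
  · rintro v₀ v₁ v₂ v₃ v₄ h₀₁ h₁₂ h₂₃ h₃₄ n₀₂ n₀₃ n₁₃ n₁₄ n₂₄ ⟨e, e'⟩
    obtain ⟨i, h₂⟩ : ∃ i, v₂ = i + (4 : ℕ) := ⟨v₂ - (4 : ℕ), by ring⟩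
    obtain ⟨p, hp, h₁⟩ := exists_mem_nbrs_of_adj (by omega) h₂ h₁₂.symm
    obtain ⟨q, hq, h₃⟩ := exists_mem_nbrs_of_adj (by omega) h₂ h₂₃
    have bp := nbrs_bounds hp
    have bq := nbrs_bounds hq
    obtain ⟨r, hr, h₀⟩ := exists_mem_nbrs_of_adj bp.1 h₁ h₀₁.symm
    obtain ⟨s, hs, h₄⟩ := exists_mem_nbrs_of_adj bq.1 h₃ h₃₄
    have comm : ∀ {a b : ℕ}, 2 ≤ a → a ≤ 6 → b ∈ nbrs a →
        windowColor (window t i) b a = windowColor (window t i) a b := by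
      intro a b ha _ hb
      simp only [nbrs, List.mem_cons, List.not_mem_nil, or_false] at hb
      unfold windowColor
      split_ifs <;> first | rfl | omega
    subst h₀ h₁ h₂ h₃ h₄
    rw [Sym2.eq_swap, edgeColor_window hn t i bp.1 bp.2 hr,
      edgeColor_window hn t i (by omega) (by omega) hq, ← comm bp.1 bp.2 hr] at e
    rw [Sym2.eq_swap, edgeColor_window hn t i (by omega) (by omega) hp,
      edgeColor_window hn t i bq.1 bq.2 hs, ← comm (by omega) (by omega) hp] at e'
    refine (ht i).2 p hp q hq ?_ r hr ?_ ?_ e s hs ?_ ?_ e' <;> rintro rfl <;> contradiction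

end Coloring

section Blocks

/-- The possible successors of position `j` in a concatenation of blocks, where the positions of
a first block of length `8` are `0, …, 7` and those of a second block of length `r` are
`8, …, 8 + r - 1`. -/
def succs (r j : ℕ) : List ℕ := if j = 7 ∨ j = r + 7 then [0, 8] else [j + 1]

/-- All windows of eight color pairs in concatenations of the two blocks listed in `L` are good. -/
def GoodBlocks (r : ℕ) (L : List ColorPair) : Prop :=
  ∀ a ∈ List.range (r + 8), ∀ b ∈ succs r a, ∀ c ∈ succs r b, ∀ d ∈ succs r c,
    ∀ e ∈ succs r d, ∀ f ∈ succs r e, ∀ g ∈ succs r f, ∀ h ∈ succs r g,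
      GoodWindow ([a, b, c, d, e, f, g, h].map fun j => L.getD j 0)

instance (r : ℕ) (L : List ColorPair) : Decidable (GoodBlocks r L) := by
  unfold GoodBlocks; infer_instance

/-- The block position of the `j`-th vertex, for one block of length `r` followed by blocks of
length `8`. -/
def blockPos (r j : ℕ) : ℕ := if j < r then 8 + j else (j - r) % 8

lemma blockPos_lt (r j : ℕ) : blockPos r j < r + 8 := by
  unfold blockPos; split_ifs <;> omega

lemma blockPos_succ_mem {n r : ℕ} [NeZero n] (hr : 0 < r) (hrn : r ≤ n) (hn : 8 ∣ n - r)
    (h1 : 1 < n) (x : ZMod n) :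
    blockPos r (x + 1).val ∈ succs r (blockPos r x.val) := by
  have hx := ZMod.val_lt x
  have : Fact (1 < n) := ⟨h1⟩
  rw [ZMod.val_add, ZMod.val_one]
  generalize x.val = j at hx
  obtain h | h : j + 1 = n ∨ j + 1 < n := by omega
  on_goal 1 => rw [h, Nat.mod_self]
  on_goal 2 => rw [Nat.mod_eq_of_lt h]
  all_goals
    unfold blockPos succs
    split_ifs <;> simp only [List.mem_cons, List.not_mem_nil, or_false, or_true] <;> omega

theorem exists_isStarEdgeColoring_of_goodBlocks {n r : ℕ} (h5 : 5 ≤ n) (hr : 0 < r)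
    (hrn : r ≤ n) (hn : 8 ∣ n - r) {L : List ColorPair} (hL : GoodBlocks r L) :
    ∃ c : Sym2 (ZMod n) → Fin 8, IsStarEdgeColoring (cycleSq n) c := by
  have : NeZero n := ⟨by omega⟩
  refine ⟨_, isStarEdgeColoring_edgeColor h5 (fun x => L.getD (blockPos r x.val) 0) fun i => ?_⟩
  have step (k m : ℕ) (h : m = k + 1) :
      blockPos r (i + (m : ℕ)).val ∈ succs r (blockPos r (i + (k : ℕ)).val) := by
    have := blockPos_succ_mem hr hrn hn (by omega) (i + (k : ℕ))
    rwa [add_assoc, ← Nat.cast_succ, Nat.succ_eq_add_one, ← h] at this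
  exact hL _ (List.mem_range.2 (blockPos_lt r _)) _ (step 0 1 rfl) _ (step 1 2 rfl)
    _ (step 2 3 rfl) _ (step 3 4 rfl) _ (step 4 5 rfl) _ (step 5 6 rfl) _ (step 6 7 rfl)

lemma goodBlocks_seven : GoodBlocks 7
    [(3, 1), (6, 4), (0, 5), (7, 1), (4, 6), (3, 6), (0, 7), (5, 2),
      (4, 2), (1, 3), (0, 3), (6, 4), (2, 7), (0, 5), (6, 2)] := by
  decide +kernel

lemma goodBlocks_nine : GoodBlocks 9
    [(0, 1), (2, 1), (4, 7), (6, 7), (0, 3), (2, 5), (4, 7), (6, 7),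
      (1, 0), (2, 3), (4, 7), (5, 6), (1, 6), (0, 2), (3, 4), (5, 7), (6, 7)] := by
  decide +kernel

lemma goodBlocks_eleven : GoodBlocks 11
    [(2, 1), (7, 3), (0, 6), (5, 2), (7, 3), (1, 5), (0, 4), (6, 4),
      (7, 1), (2, 3), (5, 6), (7, 4), (0, 2), (5, 1), (0, 7), (6, 7), (3, 4), (2, 5), (6, 0)] := by
  decide +kernel

lemma goodBlocks_thirteen : GoodBlocks 13
    [(0, 1), (2, 1), (3, 4), (5, 4), (0, 1), (2, 1), (3, 6), (5, 6),
      (0, 1), (2, 1), (3, 4), (5, 4), (0, 1), (2, 1), (3, 6), (5, 6), (0, 1), (2, 1), (3, 4),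
      (5, 7), (6, 7)] := by
  decide +kernel

end Blocks

lemma exists_isStarEdgeColoring_three :
    ∃ c : Sym2 (ZMod 3) → Fin 8, IsStarEdgeColoring (cycleSq 3) c := by
  refine ⟨Sym2.lift ⟨fun x y => Fin.castLE (by decide) (x + y : Fin 3), fun x y => ?_⟩, ?_, ?_⟩
  · exact congrArg _ (add_comm (G := Fin 3) x y)
  · intro u v w _ _ hvw h
    exact hvw (add_left_cancel (G := Fin 3) (Fin.castLE_injective (by decide : 3 ≤ 8) h))
  · intro v₀ v₁ v₂ v₃ v₄ h₀₁ h₁₂ h₂₃ _ n₀₂ n₀₃ n₁₃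
    have key : ∀ a b c d : Fin 3, ¬(a ≠ b ∧ b ≠ c ∧ c ≠ d ∧ a ≠ c ∧ a ≠ d ∧ b ≠ d) := by
      decide
    exact (key v₀ v₁ v₂ v₃ ⟨h₀₁.ne, h₁₂.ne, h₂₃.ne, n₀₂, n₀₃, n₁₃⟩).elim

end CycleSq

open CycleSq in
/-- For every odd `n ≥ 3` with `n ≠ 5` and `n ≠ 11`, `χ'_star(Cₙ²) ≤ 8`. -/
theorem starChromaticIndex_cycleSq_odd (n : ℕ) (h3 : 3 ≤ n) (hodd : Odd n)
    (h5 : n ≠ 5) (h11 : n ≠ 11) : starChromaticIndex (cycleSq n) ≤ 8 := by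
  apply Nat.sInf_le
  change ∃ c : Sym2 (ZMod n) → Fin 8, IsStarEdgeColoring (cycleSq n) c
  obtain ⟨m, rfl⟩ := hodd
  obtain rfl | h7 : m = 1 ∨ 3 ≤ m := by omega
  · exact exists_isStarEdgeColoring_three
  have h : m % 4 = 3 ∨ m % 4 = 0 ∨ m % 4 = 1 ∨ m % 4 = 2 := by omega
  rcases h with h | h | h | h
  · exact exists_isStarEdgeColoring_of_goodBlocks (by omega) (by omega) (by omega) (by omega)
      goodBlocks_seven
  · exact exists_isStarEdgeColoring_of_goodBlocks (by omega) (by omega) (by omega) (by omega)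
      goodBlocks_nine
  · exact exists_isStarEdgeColoring_of_goodBlocks (by omega) (by omega) (by omega) (by omega)
      goodBlocks_eleven
  · exact exists_isStarEdgeColoring_of_goodBlocks (by omega) (by omega) (by omega) (by omega)
      goodBlocks_thirteen
end

section
/- The star chromatic index of the square of the 5-cycle equals 9; equivalently, since C_5² is the complete graph K_5, the star chromatic index of K_5 equals 9. -/
/-- Two distinct pairs of disjoint edges of `K₅`, one of them `{01, 23}`, contain two adjacent
edges, one from each pair. -/
private lemma exists_adjacent_edges_of_pair_ne : ∀ p q r s : Fin 5,
    p ≠ q → p ≠ r → p ≠ s → q ≠ r → q ≠ s → r ≠ s →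
    s(s(p, q), s(r, s)) = s(s(0, 1), s(2, 3)) ∨
    ∃ u v, u ≠ v ∧ s(u, v) ∈ s(s(0, 1), s(2, 3)) ∧
      ∃ w, u ≠ w ∧ v ≠ w ∧ s(u, w) ∈ s(s(p, q), s(r, s)) := by
  decide

/-- Edges of `M` and `N` alternate along some path or cycle with four edges. -/
private def HasAlternatingWalk (M N : Sym2 (Sym2 (Fin 5))) : Prop :=
  ∃ v₀ v₁, v₀ ≠ v₁ ∧ s(v₀, v₁) ∈ M ∧
    ∃ v₂, v₁ ≠ v₂ ∧ v₀ ≠ v₂ ∧ s(v₁, v₂) ∈ N ∧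
    ∃ v₃, v₂ ≠ v₃ ∧ v₀ ≠ v₃ ∧ v₁ ≠ v₃ ∧ s(v₂, v₃) ∈ M ∧
    ∃ v₄, v₃ ≠ v₄ ∧ v₁ ≠ v₄ ∧ v₂ ≠ v₄ ∧ s(v₃, v₄) ∈ N

private instance : DecidableRel HasAlternatingWalk := fun M N => by
  unfold HasAlternatingWalk
  infer_instance

/-- Two pairs of disjoint edges of `K₅`, one of them `{01, 23}`, share an edge or form an
alternating path or cycle with four edges. -/
private lemma hasAlternatingWalk_of_pair_disjoint : ∀ p q r s : Fin 5,
    p ≠ q → p ≠ r → p ≠ s → q ≠ r → q ≠ s → r ≠ s →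
    (s(p, q) ∈ s(s((0 : Fin 5), 1), s(2, 3)) ∨ s(r, s) ∈ s(s((0 : Fin 5), 1), s(2, 3))) ∨
    HasAlternatingWalk s(s(0, 1), s(2, 3)) s(s(p, q), s(r, s)) := by
  decide

namespace IsStarEdgeColoring

variable {V W : Type*} {k : ℕ}

lemma comp_embedding {c : Sym2 W → Fin k} (hc : IsStarEdgeColoring ⊤ c) (σ : V ↪ W) :
    IsStarEdgeColoring (⊤ : SimpleGraph V) (c ∘ Sym2.map σ) := by
  refine ⟨fun u v w huv huw hvw => ?_, fun v₀ v₁ v₂ v₃ v₄ h01 h12 h23 h34 h02 h03 h13 h14 h24 => ?_⟩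
  · exact hc.1 (by simpa using huv) (by simpa using huw) (by simpa using hvw)
  · exact hc.2 (σ v₀) (σ v₁) (σ v₂) (σ v₃) (σ v₄) (by simpa using h01) (by simpa using h12)
      (by simpa using h23) (by simpa using h34) (by simpa using h02) (by simpa using h03)
      (by simpa using h13) (by simpa using h14) (by simpa using h24)

/-- Distinct edges of the same color have no common endpoint. -/
lemma endpoints_ne {c : Sym2 V → Fin k} (hc : IsStarEdgeColoring ⊤ c) {a b x y : V}
    (hab : a ≠ b) (hxy : x ≠ y) (hne : s(a, b) ≠ s(x, y)) (h : c s(a, b) = c s(x, y)) :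
    a ≠ x ∧ a ≠ y ∧ b ≠ x ∧ b ≠ y := by
  have key : ∀ {u v w : V}, u ≠ v → u ≠ w → s(u, v) ≠ s(u, w) → c s(u, v) ≠ c s(u, w) :=
    fun huv huw hvw => hc.1 huv huw fun e => hvw (e ▸ rfl)
  refine ⟨?_, ?_, ?_, ?_⟩ <;> rintro rfl
  · exact key hab hxy hne h
  · rw [Sym2.eq_swap (a := x)] at h hne
    exact key hab hxy.symm hne h
  · rw [Sym2.eq_swap (a := a)] at h hne
    exact key hab.symm hxy hne h
  · rw [Sym2.eq_swap (a := a), Sym2.eq_swap (a := x)] at h hne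
    exact key hab.symm hxy.symm hne h

lemma pair_eq_of_color_eq_zero_one {c : Sym2 (Fin 5) → Fin k} (hc : IsStarEdgeColoring ⊤ c)
    (h : c s(0, 1) = c s(2, 3)) {p q r s : Fin 5} (hpq : p ≠ q) (hrs : r ≠ s)
    (hne : s(p, q) ≠ s(r, s)) (h' : c s(p, q) = c s(r, s)) :
    s(s(p, q), s(r, s)) = s(s(0, 1), s(2, 3)) := by
  obtain ⟨hpr, hps, hqr, hqs⟩ := hc.endpoints_ne hpq hrs hne h'
  have h₁ : ∀ e ∈ s(s((0 : Fin 5), 1), s(2, 3)), c e = c s(0, 1) := by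
    simp [h]
  have h₂ : ∀ e ∈ s(s(p, q), s(r, s)), c e = c s(p, q) := by
    simp [h']
  have hcol : c s(0, 1) ≠ c s(p, q) ∨ s(s(p, q), s(r, s)) = s(s(0, 1), s(2, 3)) := by
    obtain he | ⟨u, v, huv, hM, w, huw, hvw, hN⟩ :=
      exists_adjacent_edges_of_pair_ne p q r s hpq hpr hps hqr hqs hrs
    · exact .inr he
    · exact .inl fun e => hc.1 huv huw hvw (by rw [h₁ _ hM, h₂ _ hN, e])
  refine hcol.resolve_left fun hcol => ?_
  obtain (hM | hM) | ⟨v₀, v₁, h01, m01, v₂, h12, h02, m12, v₃, h23, h03, h13, m23, v₄, h34, h14,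
    h24, m34⟩ := hasAlternatingWalk_of_pair_disjoint p q r s hpq hpr hps hqr hqs hrs
  · exact hcol (h₁ _ hM).symm
  · exact hcol (by rw [h', h₁ _ hM])
  · exact hc.2 v₀ v₁ v₂ v₃ v₄ h01 h12 h23 h34 h02 h03 h13 h14 h24
      ⟨by rw [h₁ _ m01, h₁ _ m23], by rw [h₂ _ m12, h₂ _ m34]⟩

/-- In a star edge-coloring of `K₅` at most one pair of edges has a common color. -/
lemma pair_eq_of_color_eq {c : Sym2 (Fin 5) → Fin k} (hc : IsStarEdgeColoring ⊤ c)
    {a b x y p q r s : Fin 5} (hab : a ≠ b) (hxy : x ≠ y) (hne : s(a, b) ≠ s(x, y))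
    (h : c s(a, b) = c s(x, y)) (hpq : p ≠ q) (hrs : r ≠ s) (hne' : s(p, q) ≠ s(r, s))
    (h' : c s(p, q) = c s(r, s)) : s(s(p, q), s(r, s)) = s(s(a, b), s(x, y)) := by
  obtain ⟨hax, hay, hbx, hby⟩ := hc.endpoints_ne hab hxy hne h
  obtain ⟨z, hz⟩ : ∃ z, z ∉ ({a, b, x, y} : Finset (Fin 5)) := by
    by_contra! hz
    have := (Finset.card_le_card fun z (_ : z ∈ Finset.univ) => hz z).trans Finset.card_le_four
    simp at this
  simp only [Finset.mem_insert, Finset.mem_singleton, not_or] at hz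
  have hinj : Function.Injective ![a, b, x, y, z] := by
    intro i j hij
    fin_cases i <;> fin_cases j <;> simp_all [eq_comm]
  let σ : Fin 5 ↪ Fin 5 := ⟨_, hinj⟩
  have hsurj : Function.Surjective σ := Finite.surjective_of_injective hinj
  obtain ⟨p, rfl⟩ := hsurj p
  obtain ⟨q, rfl⟩ := hsurj q
  obtain ⟨r, rfl⟩ := hsurj r
  obtain ⟨s, rfl⟩ := hsurj s
  have := (hc.comp_embedding σ).pair_eq_of_color_eq_zero_one h (p := p) (q := q) (r := r) (s := s)
    (fun e => hpq (e ▸ rfl)) (fun e => hrs (e ▸ rfl))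
    (fun e => hne' (congrArg (Sym2.map σ) e)) h'
  exact congrArg (Sym2.map (Sym2.map σ)) this

lemma nine_le {c : Sym2 (Fin 5) → Fin k} (hc : IsStarEdgeColoring ⊤ c) : 9 ≤ k := by
  let E : Finset (Sym2 (Fin 5)) := {e | ¬ e.IsDiag}
  have hE : E.card = 10 := by decide
  have of_injOn : ∀ S : Finset (Sym2 (Fin 5)), Set.InjOn c S → S.card ≤ k := fun S hS => by
    simpa using Finset.card_le_card_of_injOn c (fun _ _ => Finset.mem_univ _) hS
  by_cases hinj : Set.InjOn c E
  · have := of_injOn E hinj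
    omega
  · simp only [Set.InjOn, not_forall] at hinj
    obtain ⟨e, he, f, hf, hef, hne⟩ := hinj
    have hinj' : Set.InjOn c (E.erase e) := by
      intro g hg h hh hgh
      by_contra hne'
      have hpair : s(g, h) = s(e, f) := by
        simp only [E, Finset.coe_erase, Set.mem_sdiff, Finset.mem_coe, Finset.mem_filter,
          Finset.mem_univ, true_and] at he hf hg hh
        induction e with | _ a b
        induction f with | _ x y
        induction g with | _ p q
        induction h with | _ r s
        exact hc.pair_eq_of_color_eq (by simpa using he) (by simpa using hf) hne hef
          (by simpa using hg.1) (by simpa using hh.1) hne' hgh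
      have : e ∈ s(g, h) := hpair ▸ Sym2.mem_mk_left e f
      obtain rfl | rfl := Sym2.mem_iff.mp this
      · simp at hg
      · simp at hh
    have := of_injOn _ hinj'
    rw [Finset.card_erase_of_mem he] at this
    omega

end IsStarEdgeColoring

/-- The coloring of `K₅` numbering the edges in colexicographic order, except that the last edge
`34` receives the color of the first edge `01`. -/
private def colexColoring (e : Sym2 (Fin 5)) : Fin 9 :=
  Fin.ofNat 9 (e.sup.val * (e.sup.val - 1) / 2 + e.inf.val)

private lemma isStarEdgeColoring_colexColoring : IsStarEdgeColoring ⊤ colexColoring := by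
  have path : ∀ v₀ v₁ : Fin 5, v₀ ≠ v₁ → ∀ v₂, v₁ ≠ v₂ → v₀ ≠ v₂ → ∀ v₃, v₂ ≠ v₃ → v₀ ≠ v₃ →
      v₁ ≠ v₃ → colexColoring s(v₀, v₁) = colexColoring s(v₂, v₃) → ∀ v₄, v₃ ≠ v₄ → v₁ ≠ v₄ →
      v₂ ≠ v₄ → colexColoring s(v₁, v₂) ≠ colexColoring s(v₃, v₄) := by
    decide
  refine ⟨by decide, fun v₀ v₁ v₂ v₃ v₄ h01 h12 h23 h34 h02 h03 h13 h14 h24 h => ?_⟩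
  exact path v₀ v₁ h01 v₂ h12 h02 v₃ h23 h03 h13 h.1 v₄ h34 h14 h24 h.2

lemma starChromaticIndex_top_fin_five : starChromaticIndex (⊤ : SimpleGraph (Fin 5)) = 9 :=
  IsLeast.csInf_eq ⟨⟨_, isStarEdgeColoring_colexColoring⟩, fun _ ⟨_, hc⟩ => hc.nine_le⟩

lemma cycleSq_five_eq_top : cycleSq 5 = ⊤ := by
  ext a b
  simp only [cycleSq, SimpleGraph.fromRel_adj, SimpleGraph.top_adj]
  revert a b
  decide

/-- `χ'_star(C₅²) = 9`; equivalently, since `C₅²` is the complete graph `K₅`,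
`χ'_star(K₅) = 9`. -/
theorem starChromaticIndex_cycleSq_five :
    starChromaticIndex (cycleSq 5) = 9 ∧
      starChromaticIndex (⊤ : SimpleGraph (Fin 5)) = 9 := by
  rw [cycleSq_five_eq_top]
  exact ⟨starChromaticIndex_top_fin_five, starChromaticIndex_top_fin_five⟩
end

section
/- The star chromatic index of the graph H_0 is at least 5; that is, H_0 admits no star 4-edge-coloring. -/
/-- The graph `H₀` on 12 vertices: a triangle `x₁x₂x₃` (here `0, 1, 2`), spokes
`xⱼyⱼ` (with `y₁, y₂, y₃` being `3, 4, 5`), and two pendant edges `yⱼzⱼ, yⱼzⱼ'`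
at each `yⱼ` (the leaves being `6, …, 11`). -/
def graphH0 : SimpleGraph (Fin 12) :=
  SimpleGraph.fromRel (fun a b =>
    (a = 0 ∧ b = 1) ∨ (a = 1 ∧ b = 2) ∨ (a = 2 ∧ b = 0) ∨
    (a = 0 ∧ b = 3) ∨ (a = 1 ∧ b = 4) ∨ (a = 2 ∧ b = 5) ∨
    (a = 3 ∧ b = 6) ∨ (a = 3 ∧ b = 7) ∨ (a = 4 ∧ b = 8) ∨
    (a = 4 ∧ b = 9) ∨ (a = 5 ∧ b = 10) ∨ (a = 5 ∧ b = 11))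

theorem isStarEdgeColoring_of_injective {V : Type*} (G : SimpleGraph V) {k : ℕ}
    {c : Sym2 V → Fin k} (hc : Function.Injective c) : IsStarEdgeColoring G c := by
  refine ⟨fun u v w _ _ hvw h => hvw (Sym2.congr_right.mp (hc h)), ?_⟩
  rintro v₀ v₁ v₂ v₃ v₄ - - - - h₀₂ h₀₃ - - - ⟨h, -⟩
  have := hc h
  simp_all

theorem exists_isStarEdgeColoring {V : Type*} [Finite V] (G : SimpleGraph V) :
    ∃ (k : ℕ) (c : Sym2 V → Fin k), IsStarEdgeColoring G c :=
  ⟨_, Finite.equivFin _, isStarEdgeColoring_of_injective G (Finite.equivFin _).injective⟩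

theorem IsStarEdgeColoring.castLE {V : Type*} {G : SimpleGraph V} {k l : ℕ} {c : Sym2 V → Fin k}
    (hc : IsStarEdgeColoring G c) (h : k ≤ l) :
    IsStarEdgeColoring G fun e => Fin.castLE h (c e) := by
  simpa [IsStarEdgeColoring] using hc

theorem Fin.eq_of_four_distinct {a b p d : Fin 4} (hab : a ≠ b) (hbp : b ≠ p) (hpa : p ≠ a)
    (hda : d ≠ a) (hdb : d ≠ b) (hdp : d ≠ p) (x : Fin 4) : x = a ∨ x = b ∨ x = p ∨ x = d := by
  decide +revert

/-- Suppose the triangle edges `x₁x₂`, `x₂x₃`, `x₃x₁` have colors `a`, `b`, `p`, the spoke at `xⱼ`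
has color `dⱼ`, and the pendant edges beyond it have colors `eⱼ`, `fⱼ`. Then the first two spokes
have distinct colors. -/
theorem spoke_color_ne {a b p d₁ d₂ d₃ e₁ f₁ e₃ f₃ : Fin 4}
    (hab : a ≠ b) (hbp : b ≠ p) (hpa : p ≠ a)
    (hd₁a : d₁ ≠ a) (hd₁p : d₁ ≠ p) (hd₂b : d₂ ≠ b) (hd₃b : d₃ ≠ b) (hd₃p : d₃ ≠ p)
    (he₁ : e₁ ≠ d₁) (hf₁ : f₁ ≠ d₁) (hef₁ : e₁ ≠ f₁)
    (he₃ : e₃ ≠ d₃) (hf₃ : f₃ ≠ d₃) (hef₃ : e₃ ≠ f₃)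
    (he₁a : ¬(e₁ = a ∧ d₁ = d₂)) (hf₁a : ¬(f₁ = a ∧ d₁ = d₂))
    (he₁p : ¬(e₁ = p ∧ d₁ = d₃)) (hf₁p : ¬(f₁ = p ∧ d₁ = d₃))
    (he₃p : ¬(e₃ = p ∧ d₃ = a)) (hf₃p : ¬(f₃ = p ∧ d₃ = a))
    (he₃b : ¬(e₃ = b ∧ d₃ = a)) (hf₃b : ¬(f₃ = b ∧ d₃ = a)) : d₁ ≠ d₂ := by
  rintro rfl
  have H := Fin.eq_of_four_distinct hab hbp hpa hd₁a hd₂b hd₁p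
  have := H e₁
  have := H f₁
  have := H d₃
  have := H e₃
  have := H f₃
  grind

theorem spoke_color_ne_of_isStarEdgeColoring {V : Type*} {G : SimpleGraph V} {c : Sym2 V → Fin 4}
    (hc : IsStarEdgeColoring G c) {x₁ x₂ x₃ y₁ y₂ y₃ z₁ w₁ z₃ w₃ : V}
    (hn : [x₁, x₂, x₃, y₁, y₂, y₃, z₁, w₁, z₃, w₃].Nodup)
    (h₁₂ : G.Adj x₁ x₂) (h₂₃ : G.Adj x₂ x₃) (h₃₁ : G.Adj x₃ x₁)
    (k₁ : G.Adj x₁ y₁) (k₂ : G.Adj x₂ y₂) (k₃ : G.Adj x₃ y₃)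
    (l₁ : G.Adj y₁ z₁) (m₁ : G.Adj y₁ w₁) (l₃ : G.Adj y₃ z₃) (m₃ : G.Adj y₃ w₃) :
    c s(x₁, y₁) ≠ c s(x₂, y₂) := by
  obtain ⟨hp, hs⟩ := hc
  simp only [List.nodup_cons, List.mem_cons, List.not_mem_nil, not_or] at hn
  have swap : ∀ u v, c s(u, v) = c s(v, u) := fun u v => by rw [Sym2.eq_swap]
  have := h₁₂.symm
  have := h₂₃.symm
  have := h₃₁.symm
  have := k₁.symm
  have := k₂.symm
  have := k₃.symm
  have := l₁.symm
  have := m₁.symm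
  have := l₃.symm
  have := m₃.symm
  apply spoke_color_ne (a := c s(x₁, x₂)) (b := c s(x₂, x₃)) (p := c s(x₃, x₁))
    (d₃ := c s(x₃, y₃)) (e₁ := c s(y₁, z₁)) (f₁ := c s(y₁, w₁)) (e₃ := c s(y₃, z₃))
    (f₃ := c s(y₃, w₃)) <;> grind -lia

/-- Three spokes at a triangle with edge colors `a`, `b`, `p` cannot have three distinct colors. -/
theorem spoke_colors_not_distinct {a b p d₁ d₂ d₃ : Fin 4}
    (hab : a ≠ b) (hbp : b ≠ p) (hpa : p ≠ a)
    (hd₁a : d₁ ≠ a) (hd₁p : d₁ ≠ p) (hd₂a : d₂ ≠ a) (hd₂b : d₂ ≠ b) (hd₃b : d₃ ≠ b) (hd₃p : d₃ ≠ p)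
    (h₁₂ : ¬(d₁ = b ∧ p = d₂)) (h₂₃ : ¬(d₂ = p ∧ a = d₃)) (h₃₁ : ¬(d₃ = a ∧ b = d₁)) :
    ¬(d₁ ≠ d₂ ∧ d₂ ≠ d₃ ∧ d₃ ≠ d₁) := by
  decide +revert

theorem not_isStarEdgeColoring_graphH0 (c : Sym2 (Fin 12) → Fin 4) :
    ¬IsStarEdgeColoring graphH0 c := by
  intro hc
  have h₁₂ : c s(0, 3) ≠ c s(1, 4) := by
    refine spoke_color_ne_of_isStarEdgeColoring hc (x₃ := 2) (y₃ := 5) (z₁ := 6) (w₁ := 7)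
      (z₃ := 10) (w₃ := 11) (by decide) ?_ ?_ ?_ ?_ ?_ ?_ ?_ ?_ ?_ ?_ <;> simp [graphH0]
  have h₂₃ : c s(1, 4) ≠ c s(2, 5) := by
    refine spoke_color_ne_of_isStarEdgeColoring hc (x₃ := 0) (y₃ := 3) (z₁ := 8) (w₁ := 9)
      (z₃ := 6) (w₃ := 7) (by decide) ?_ ?_ ?_ ?_ ?_ ?_ ?_ ?_ ?_ ?_ <;> simp [graphH0]
  have h₃₁ : c s(2, 5) ≠ c s(0, 3) := by
    refine spoke_color_ne_of_isStarEdgeColoring hc (x₃ := 1) (y₃ := 4) (z₁ := 10) (w₁ := 11)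
      (z₃ := 8) (w₃ := 9) (by decide) ?_ ?_ ?_ ?_ ?_ ?_ ?_ ?_ ?_ ?_ <;> simp [graphH0]
  obtain ⟨hp, hs⟩ := hc
  have swap₀₁ : s((0 : Fin 12), 1) = s(1, 0) := Sym2.eq_swap
  have swap₁₂ : s((1 : Fin 12), 2) = s(2, 1) := Sym2.eq_swap
  have swap₂₀ : s((2 : Fin 12), 0) = s(0, 2) := Sym2.eq_swap
  have swap₀₃ : s((3 : Fin 12), 0) = s(0, 3) := Sym2.eq_swap
  have swap₁₄ : s((4 : Fin 12), 1) = s(1, 4) := Sym2.eq_swap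
  have swap₂₅ : s((5 : Fin 12), 2) = s(2, 5) := Sym2.eq_swap
  refine spoke_colors_not_distinct (a := c s(0, 1)) (b := c s(1, 2)) (p := c s(2, 0))
    ?_ ?_ ?_ ?_ ?_ ?_ ?_ ?_ ?_ ?_ ?_ ?_ ⟨h₁₂, h₂₃, h₃₁⟩
  · rw [swap₀₁]; apply hp <;> simp [graphH0]
  · rw [swap₁₂]; apply hp <;> simp [graphH0]
  · rw [swap₂₀]; apply hp <;> simp [graphH0]
  · apply hp <;> simp [graphH0]
  · rw [swap₂₀]; apply hp <;> simp [graphH0]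
  · rw [swap₀₁]; apply hp <;> simp [graphH0]
  · apply hp <;> simp [graphH0]
  · rw [swap₁₂]; apply hp <;> simp [graphH0]
  · apply hp <;> simp [graphH0]
  · rw [swap₁₂, swap₂₀, ← swap₀₃]; apply hs <;> simp [graphH0]
  · rw [swap₂₀, swap₀₁, ← swap₁₄]; apply hs <;> simp [graphH0]
  · rw [swap₀₁, swap₁₂, ← swap₂₅]; apply hs <;> simp [graphH0]

/-- The star chromatic index of `H₀` is at least 5: `H₀` admits no star
4-edge-coloring. -/
theorem starChromaticIndex_H0 : 5 ≤ starChromaticIndex graphH0 := by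
  refine le_csInf (exists_isStarEdgeColoring _) ?_
  rintro k ⟨c, hc⟩
  by_contra! h
  exact not_isStarEdgeColoring_graphH0 _ (hc.castLE (Nat.le_of_lt_succ h))
end
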